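/- Let U, V be multisets of linear forms each of size d > 0, and let I_1,...,I_r be orthogonal form-ideals such that for each i ∈ [r] there is an ideal matching between U and V by I_i. If r > log_2(d) + 2, then U and V are similar multisets. -/

import Mathlib

def matchRel {F : Type*} [Field F] {n : ℕ} (I : Set (Fin n → F))
    (u v : Fin n → F) : Prop :=
  ∃ c : F, c ≠ 0 ∧ ∃ w ∈ Submodule.span F I, v = c • u + w

namespace Multiset

theorem Rel.countP_eq_countP {α β : Type*} {R : α → β → Prop} {p : α → Prop} {q : β → Prop}
    [DecidablePred p] [DecidablePred q] (h : ∀ a b, R a b → (p a ↔ q b))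
    {s : Multiset α} {t : Multiset β} (hst : Rel R s t) : countP p s = countP q t := by
  induction hst with
  | zero => simp
  | cons hab _ ih => simp [countP_cons, h _ _ hab, ih]

theorem disjoint_tsub_tsub {α : Type*} [DecidableEq α] (s t : Multiset α) :
    Disjoint (s - t) (t - s) := by
  rw [disjoint_left]
  intro a hs ht
  rw [← count_pos, count_sub] at hs ht
  omega

/-- If two multisets contain equally many elements satisfying a predicate, so do the multisets
obtained by cancelling their common part. -/
theorem countP_tsub_eq_countP_tsub {α : Type*} [DecidableEq α] {s t : Multiset α}
    (p : α → Prop) [DecidablePred p] (h : countP p s = countP p t) :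
    countP p (s - t) = countP p (t - s) := by
  have hs := congrArg (countP p) (sub_add_inter s t)
  have ht := congrArg (countP p) (sub_add_inter t s)
  rw [countP_add] at hs ht
  rw [inter_comm] at ht
  omega

end Multiset

section LinearAlgebra

variable {F E : Type*} [Field F] [AddCommGroup E] [Module F E]

/-- Two vectors are congruent up to a nonzero scalar modulo `S`. -/
def ProjModEq (S : Submodule F E) (u v : E) : Prop :=
  ∃ c : F, c ≠ 0 ∧ ∃ w ∈ S, v = c • u + w

theorem ProjModEq.equivalence (S : Submodule F E) : Equivalence (ProjModEq S) where
  refl u := ⟨1, one_ne_zero, 0, S.zero_mem, by simp⟩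
  symm := by
    rintro u _ ⟨c, hc, w, hw, rfl⟩
    exact ⟨c⁻¹, inv_ne_zero hc, -(c⁻¹ • w), S.neg_mem (S.smul_mem _ hw), by
      simp [smul_add, smul_smul, hc]⟩
  trans := by
    rintro u _ _ ⟨c, hc, w, hw, rfl⟩ ⟨c', hc', w', hw', rfl⟩
    exact ⟨c' * c, mul_ne_zero hc' hc, c' • w + w', S.add_mem (S.smul_mem _ hw) hw', by
      rw [smul_add, mul_smul, add_assoc]⟩

theorem ProjModEq.mono {S T : Submodule F E} (h : S ≤ T) {u v : E} :
    ProjModEq S u v → ProjModEq T u v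
  | ⟨c, hc, w, hw, e⟩ => ⟨c, hc, w, h hw, e⟩

/-- Proportionality by nonzero scalars. -/
def proportionalSetoid (F E : Type*) [Field F] [AddCommGroup E] [Module F E] : Setoid E where
  r := ProjModEq (⊥ : Submodule F E)
  iseqv := ProjModEq.equivalence ⊥

/-- A nonempty finite set in which every point can be moved inside the set by a nonzero vector of
each of the independent submodules `S j`, `j ∈ J`, has at least `2 ^ #J` points. -/
theorem two_pow_card_le_card_of_supIndep {ι : Type*} [DecidableEq ι] {S : ι → Submodule F E}
    {J : Finset ι} (hJ : J.SupIndep S) (T : Finset E) (hT : T.Nonempty)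
    (hmove : ∀ y ∈ T, ∀ j ∈ J, ∃ z ∈ T, z ≠ y ∧ z - y ∈ S j) : 2 ^ J.card ≤ T.card := by
  classical
  induction J using Finset.induction_on generalizing T with
  | empty => simpa using hT
  | insert k J hk ih =>
    have hdisj : Disjoint (S k) (J.sup S) :=
      hJ (Finset.subset_insert k J) (Finset.mem_insert_self k J) hk
    have slice : ∀ x ∈ T, 2 ^ J.card ≤ (T.filter fun y => y - x ∈ J.sup S).card := by
      intro x hx
      refine ih (hJ.subset (Finset.subset_insert k J)) _
        ⟨x, Finset.mem_filter.2 ⟨hx, by simp⟩⟩ fun y hy j hj => ?_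
      rw [Finset.mem_filter] at hy
      obtain ⟨z, hz, hzy, hzS⟩ := hmove y hy.1 j (Finset.mem_insert_of_mem hj)
      refine ⟨z, Finset.mem_filter.2 ⟨hz, ?_⟩, hzy, hzS⟩
      rw [← sub_add_sub_cancel z y x]
      exact add_mem (Finset.le_sup (f := S) hj hzS) hy.2
    obtain ⟨x, hx⟩ := hT
    obtain ⟨x', hx', hne, hsub⟩ := hmove x hx k (Finset.mem_insert_self k J)
    rw [Finset.card_insert_of_notMem hk, pow_succ, mul_two]
    refine (add_le_add (slice x hx) (slice x' hx')).trans ?_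
    rw [← Finset.card_union_of_disjoint]
    · exact Finset.card_le_card
        (Finset.union_subset (Finset.filter_subset _ _) (Finset.filter_subset _ _))
    · rw [Finset.disjoint_left]
      intro y hy hy'
      rw [Finset.mem_filter] at hy hy'
      refine hne (sub_eq_zero.1 (Submodule.disjoint_def.1 hdisj _ hsub ?_))
      rw [← sub_sub_sub_cancel_left x x' y]
      simpa using sub_mem hy.2 hy'.2

/-- A nonzero vector avoids the sum of some all-but-one of the members of an independent family. -/
theorem exists_notMem_sup_erase {ι : Type*} [DecidableEq ι] {S : ι → Submodule F E} {s : Finset ι}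
    (hs : s.Nonempty) (hS : s.SupIndep S) {x : E} (hx : x ≠ 0) :
    ∃ k ∈ s, x ∉ (s.erase k).sup S := by
  classical
  by_contra! hall
  obtain ⟨k₀, hk₀⟩ := hs
  have hne : (s.powerset.filter fun J => x ∈ J.sup S).Nonempty :=
    ⟨s.erase k₀, by simp [Finset.erase_subset, hall k₀ hk₀]⟩
  obtain ⟨J, hJ, hmin⟩ := Finset.exists_min_image _ Finset.card hne
  rw [Finset.mem_filter, Finset.mem_powerset] at hJ
  obtain rfl | ⟨k, hk⟩ := J.eq_empty_or_nonempty
  · exact hx (by simpa using hJ.2)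
  have hxJ := hJ.2
  rw [← Finset.insert_erase hk, Finset.sup_insert] at hxJ
  obtain ⟨b, hb, a, ha, rfl⟩ := Submodule.mem_sup.1 hxJ
  have hb0 : b = 0 := by
    refine Submodule.disjoint_def.1
      (hS (Finset.erase_subset k s) (hJ.1 hk) (Finset.notMem_erase k s)) b hb ?_
    have := sub_mem (hall k (hJ.1 hk))
      (SetLike.le_def.1 (Finset.sup_mono (Finset.erase_subset_erase k hJ.1)) ha)
    simpa using this
  subst hb0
  have := hmin (J.erase k) (Finset.mem_filter.2
    ⟨Finset.mem_powerset.2 ((Finset.erase_subset k J).trans hJ.1), by simpa using ha⟩)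
  have := Finset.card_erase_lt_of_mem hk
  omega

theorem supIndep_of_forall_disjoint_lt {ι : Type*} [LinearOrder ι] {S : ι → Submodule F E}
    (s : Finset ι) (h : ∀ i, ∀ t : Finset ι, (∀ j ∈ t, j < i) → Disjoint (S i) (t.sup S)) :
    s.SupIndep S := by
  induction s using Finset.induction_on_max with
  | empty => exact Finset.supIndep_empty S
  | insert a s hs ih => exact ih.insert (h a s hs)

/-- Multisets of vectors matched modulo each member of a large enough independent family of
submodules agree up to nonzero scalars. -/
theorem Multiset.rel_projModEq_bot_of_supIndep {ι : Type*} [DecidableEq ι]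
    {S : ι → Submodule F E} {s : Finset ι} (hs : s.Nonempty) (hS : s.SupIndep S)
    {U V : Multiset E} (hmatch : ∀ i ∈ s, Multiset.Rel (ProjModEq (S i)) U V)
    (hcard : 2 * Multiset.card U < 2 ^ (s.card - 1)) :
    Multiset.Rel (ProjModEq (⊥ : Submodule F E)) U V := by
  classical
  let q : E → Quotient (proportionalSetoid F E) := Quotient.mk _
  have hq : ∀ {u v}, q u = q v ↔ ProjModEq (⊥ : Submodule F E) u v := Quotient.eq
  suffices h : U.map q = V.map q by
    rw [← Multiset.rel_eq, Multiset.rel_map] at h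
    exact h.mono fun _ _ _ _ h => hq.1 h
  set A := U.map q - V.map q
  set B := V.map q - U.map q
  have hUV : Multiset.card U = Multiset.card V :=
    Multiset.card_eq_card_of_rel (hmatch _ hs.choose_spec)
  have hAB : Multiset.card A = Multiset.card B := by
    simpa using Multiset.countP_tsub_eq_countP_tsub (s := U.map q) (t := V.map q)
      (fun _ => True) (by simpa using hUV)
  have hdisj : Disjoint A B := Multiset.disjoint_tsub_tsub _ _
  have hAU : Multiset.card A ≤ Multiset.card U :=
    (Multiset.card_le_card (Multiset.sub_le_self _ _)).trans_eq (Multiset.card_map _ _)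
  have hcount : ∀ i ∈ s, ∀ y : E,
      Multiset.countP (fun c => ∃ z, q z = c ∧ ProjModEq (S i) y z) A =
      Multiset.countP (fun c => ∃ z, q z = c ∧ ProjModEq (S i) y z) B := by
    intro i hi y
    have hE := ProjModEq.equivalence (S i)
    have hiff : ∀ v, (∃ z, q z = q v ∧ ProjModEq (S i) y z) ↔ ProjModEq (S i) y v := fun v =>
      ⟨fun ⟨z, hz, hyz⟩ => hE.trans hyz ((hq.1 hz).mono bot_le), fun h => ⟨v, rfl, h⟩⟩
    apply Multiset.countP_tsub_eq_countP_tsub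
    have := Multiset.Rel.countP_eq_countP (p := fun v => ∃ z, q z = q v ∧ ProjModEq (S i) y z)
      (q := fun v => ∃ z, q z = q v ∧ ProjModEq (S i) y z) (fun a b hab => by
        rw [hiff, hiff]
        exact ⟨fun h => hE.trans h hab, fun h => hE.trans h (hE.symm hab)⟩) (hmatch i hi)
    rw [Multiset.countP_map, Multiset.countP_map, ← Multiset.countP_eq_card_filter,
      ← Multiset.countP_eq_card_filter]
    exact this
  have hpartner : ∀ i ∈ s, ∀ y : E, q y ∈ A + B →
      ∃ z, q z ∈ A + B ∧ q z ≠ q y ∧ ProjModEq (S i) y z := by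
    intro i hi y hy
    have hyP : ∃ z, q z = q y ∧ ProjModEq (S i) y z :=
      ⟨y, rfl, (ProjModEq.equivalence (S i)).refl y⟩
    rcases Multiset.mem_add.1 hy with hy | hy
    · have hpos := Multiset.countP_pos_of_mem
        (p := fun c => ∃ z, q z = c ∧ ProjModEq (S i) y z) hy hyP
      rw [hcount i hi y, Multiset.countP_pos] at hpos
      obtain ⟨_, hz, z, rfl, hyz⟩ := hpos
      exact ⟨z, Multiset.mem_add.2 (.inr hz),
        fun h => Multiset.disjoint_left.1 hdisj hy (h ▸ hz), hyz⟩
    · have hpos := Multiset.countP_pos_of_mem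
        (p := fun c => ∃ z, q z = c ∧ ProjModEq (S i) y z) hy hyP
      rw [← hcount i hi y, Multiset.countP_pos] at hpos
      obtain ⟨_, hz, z, rfl, hyz⟩ := hpos
      exact ⟨z, Multiset.mem_add.2 (.inl hz),
        fun h => Multiset.disjoint_left.1 hdisj hz (h ▸ hy), hyz⟩
  by_contra hne
  obtain ⟨x, hx, hx0⟩ : ∃ x, q x ∈ A + B ∧ x ≠ 0 := by
    obtain ⟨y, hy⟩ : ∃ y, q y ∈ A + B := by
      by_contra! hempty
      have hall : A + B = 0 := Multiset.eq_zero_of_forall_notMem fun c => by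
        induction c using Quotient.inductionOn with | h y => exact hempty y
      obtain ⟨hA0, hB0⟩ := add_eq_zero.1 hall
      exact hne (le_antisymm (tsub_eq_zero_iff_le.1 hA0) (tsub_eq_zero_iff_le.1 hB0))
    obtain ⟨i, hi⟩ := hs
    obtain ⟨z, hz, hzy, -⟩ := hpartner i hi y hy
    by_cases hy0 : y = 0
    · exact ⟨z, hz, fun h => hzy (by rw [h, hy0])⟩
    · exact ⟨y, hy, hy0⟩
  obtain ⟨k, hk, hxk⟩ := exists_notMem_sup_erase hs hS hx0
  obtain ⟨φ, hφx, hφ⟩ := Submodule.exists_le_ker_of_notMem hxk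
  have hnorm : ∀ z, φ z ≠ 0 → q ((φ z)⁻¹ • z) = q z := fun z hz =>
    hq.2 ⟨φ z, hz, 0, zero_mem _, by simp [smul_smul, hz]⟩
  have hinj : Set.InjOn q {y | φ y = 1} := by
    intro y hy z hz hyz
    obtain ⟨c, -, w, hw, rfl⟩ := hq.1 hyz
    rw [Submodule.mem_bot] at hw
    subst hw
    have hy1 : φ y = 1 := hy
    have hc : c = 1 := by simpa [hy1] using hz
    simp [hc]
  have hfin : {y | φ y = 1 ∧ q y ∈ A + B}.Finite := by
    refine Set.Finite.of_finite_image (f := q) ((A + B).toFinset.finite_toSet.subset ?_)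
      (hinj.mono fun y hy => hy.1)
    rintro _ ⟨y, hy, rfl⟩
    simpa using hy.2
  have hT : ∀ y, y ∈ hfin.toFinset ↔ φ y = 1 ∧ q y ∈ A + B := fun y => hfin.mem_toFinset
  have hlower : 2 ^ (s.erase k).card ≤ hfin.toFinset.card := by
    refine two_pow_card_le_card_of_supIndep (hS.subset (Finset.erase_subset k s)) _
      ⟨(φ x)⁻¹ • x, (hT _).2 ⟨by simp [hφx], by rwa [hnorm x hφx]⟩⟩ fun y hy j hj => ?_
    obtain ⟨hy1, hyAB⟩ := (hT y).1 hy
    obtain ⟨z, hz, hzy, c, hc, w, hw, rfl⟩ := hpartner j (Finset.mem_of_mem_erase hj) y hyAB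
    have hφw : φ w = 0 := hφ (Finset.le_sup (f := S) hj hw)
    have hφz : φ (c • y + w) = c := by simp [hy1, hφw]
    have hz' := hnorm (c • y + w) (by rwa [hφz])
    rw [hφz] at hz'
    refine ⟨c⁻¹ • (c • y + w), (hT _).2 ⟨?_, by rwa [hz']⟩, fun h => hzy ?_, ?_⟩
    · rw [map_smul, hφz, smul_eq_mul, inv_mul_cancel₀ hc]
    · rw [← hz', h]
    · have : c⁻¹ • (c • y + w) - y = c⁻¹ • w := by simp [smul_add, smul_smul, hc]
      rw [this]
      exact (S j).smul_mem _ hw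
  have hupper : hfin.toFinset.card ≤ Multiset.card (A + B) := by
    refine (Finset.card_le_card_of_injOn q (fun y hy => ?_) (hinj.mono fun y hy => ?_)).trans
      (Multiset.toFinset_card_le (A + B))
    · exact Multiset.mem_toFinset.2 ((hT y).1 hy).2
    · exact ((hT y).1 hy).1
  rw [Finset.card_erase_of_mem hk] at hlower
  rw [Multiset.card_add] at hupper
  omega

end LinearAlgebra

/-- if `U`, `V` of size `d > 0` admit ideal matchings by `r` orthogonal
form-ideals with `r > log₂ d + 2`, then `U` and `V` are similar multisets. -/
theorem stmt4 {F : Type*} [Field F] {n : ℕ} (d r : ℕ) (hd : 0 < d)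
    (U V : Multiset (Fin n → F))
    (hU : Multiset.card U = d) (hV : Multiset.card V = d)
    (I : Fin r → Set (Fin n → F))
    (hne : ∀ i, (I i).Nonempty)
    (horth : ∀ i : Fin r,
      Submodule.span F (⋃ j, ⋃ _ : j < i, I j) ⊓ Submodule.span F (I i) = ⊥)
    (hmatch : ∀ i, Multiset.Rel (matchRel (I i)) U V)
    (hr : (r : ℝ) > Real.logb 2 (d : ℝ) + 2) :
    Multiset.Rel (fun u v => ∃ e : F, e ≠ 0 ∧ v = e • u) U V := by
  have hlog : 0 ≤ Real.logb 2 (d : ℝ) :=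
    Real.logb_nonneg one_lt_two (by exact_mod_cast hd)
  have hr2 : 2 < r := by
    have : (2 : ℝ) < r := by linarith
    exact_mod_cast this
  obtain ⟨m, rfl⟩ := Nat.exists_eq_add_of_le' hr2.le
  have hdm : d < 2 ^ m := by
    have h : Real.logb 2 (d : ℝ) < (m : ℝ) := by push_cast at hr; linarith
    rw [Real.logb_lt_iff_lt_rpow one_lt_two (by exact_mod_cast hd), Real.rpow_natCast] at h
    exact_mod_cast h
  have hS : (Finset.univ : Finset (Fin (m + 2))).SupIndep fun i => Submodule.span F (I i) := by
    refine supIndep_of_forall_disjoint_lt _ fun i t ht => ?_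
    refine (disjoint_iff.2 (horth i)).symm.mono_right (Finset.sup_le fun j hj => ?_)
    exact Submodule.span_mono (Set.subset_iUnion₂_of_subset j (ht j hj) subset_rfl)
  have key := Multiset.rel_projModEq_bot_of_supIndep ⟨0, Finset.mem_univ 0⟩ hS
    (fun i _ => hmatch i) (by
      rw [hU, Finset.card_univ, Fintype.card_fin, Nat.add_succ_sub_one, pow_succ]
      omega)
  refine key.mono fun u _ v _ ⟨c, hc, w, hw, e⟩ => ⟨c, hc, ?_⟩
  rw [e, (Submodule.mem_bot F).1 hw, add_zero]
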